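/- For any δ > 0, any Borel probability measure P on ℝ^d, and any α ∈ (0,1], the upper level set {z ∈ ℝ^d : D_δ(z|P) ≥ α} of the distributionally robust halfspace depth is convex. -/

import Mathlib

open MeasureTheory RealInnerProductSpace
open scoped ENNReal

abbrev Ed (d : ℕ) := EuclideanSpace ℝ (Fin d)

/-- 1-Wasserstein distance between Borel measures on `ℝ^d`. -/
noncomputable def wassersteinDist {d : ℕ} (P Q : Measure (Ed d)) : ℝ≥0∞ :=
  ⨅ (π : Measure (Ed d × Ed d)) (_ : π.map Prod.fst = P) (_ : π.map Prod.snd = Q),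
    ∫⁻ p, ENNReal.ofReal ‖p.1 - p.2‖ ∂π

/-- Worst-case probability of a set over the Wasserstein ball of radius `δ` around `P`. -/
noncomputable def supProb {d : ℕ} (δ : ℝ) (P : Measure (Ed d)) (A : Set (Ed d)) : ℝ :=
  sSup {v : ℝ | ∃ Q : Measure (Ed d), IsProbabilityMeasure Q ∧
    wassersteinDist Q P ≤ ENNReal.ofReal δ ∧ v = (Q A).toReal}

/-- Distributionally robust halfspace depth. -/
noncomputable def robustDepth {d : ℕ} (δ : ℝ) (z : Ed d) (P : Measure (Ed d)) : ℝ :=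
  sInf {v : ℝ | ∃ u : Ed d, ‖u‖ = 1 ∧ v = supProb δ P {x | 0 ≤ ⟪u, x - z⟫}}

theorem supProb_nonneg {d : ℕ} (δ : ℝ) (P : Measure (Ed d)) (A : Set (Ed d)) :
    0 ≤ supProb δ P A := by
  refine Real.sSup_nonneg ?_
  rintro _ ⟨Q, -, -, rfl⟩
  exact ENNReal.toReal_nonneg

theorem supProb_mono {d : ℕ} (δ : ℝ) (P : Measure (Ed d)) {A B : Set (Ed d)} (h : A ⊆ B) :
    supProb δ P A ≤ supProb δ P B := by
  refine Real.sSup_le ?_ (supProb_nonneg δ P B)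
  rintro _ ⟨Q, hQ, hW, rfl⟩
  have hB : BddAbove {v : ℝ | ∃ Q : Measure (Ed d), IsProbabilityMeasure Q ∧
      wassersteinDist Q P ≤ ENNReal.ofReal δ ∧ v = (Q B).toReal} := by
    refine ⟨1, ?_⟩
    rintro _ ⟨R, hR, -, rfl⟩
    exact measureReal_le_one
  exact (measureReal_mono h).trans (le_csSup hB ⟨Q, hQ, hW, rfl⟩)

theorem robustDepth_le_supProb {d : ℕ} (δ : ℝ) (z : Ed d) (P : Measure (Ed d)) {u : Ed d}
    (hu : ‖u‖ = 1) : robustDepth δ z P ≤ supProb δ P {x | 0 ≤ ⟪u, x - z⟫} := by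
  refine csInf_le ⟨0, ?_⟩ ⟨u, hu, rfl⟩
  rintro _ ⟨w, -, rfl⟩
  exact supProb_nonneg δ P _

/-- **Convex upper level sets (P3).** For every `α ∈ (0,1]` the upper level set
`{z : D_δ(z|P) ≥ α}` is convex. -/
theorem robustDepth_upperLevelSet_convex {d : ℕ} (δ : ℝ) (hδ : 0 < δ)
    (P : Measure (Ed d)) [IsProbabilityMeasure P] (α : ℝ) (hα : α ∈ Set.Ioc (0:ℝ) 1) :
    Convex ℝ {z : Ed d | α ≤ robustDepth δ z P} := by
  intro y hy z hz a b ha hb hab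
  have hne : {v : ℝ | ∃ u : Ed d, ‖u‖ = 1 ∧ v = supProb δ P {x | 0 ≤ ⟪u, x - y⟫}}.Nonempty := by
    by_contra h
    have hy' : α ≤ robustDepth δ y P := hy
    rw [robustDepth, Set.not_nonempty_iff_eq_empty.mp h, Real.sInf_empty] at hy'
    exact absurd hα.1 hy'.not_gt
  obtain ⟨_, u₀, hu₀, -⟩ := hne
  rw [Set.mem_ofPred_eq, robustDepth]
  refine le_csInf ⟨_, u₀, hu₀, rfl⟩ ?_
  rintro _ ⟨u, hu, rfl⟩
  have key : ∀ w : Ed d, α ≤ robustDepth δ w P → ⟪u, a • y + b • z⟫ ≤ ⟪u, w⟫ →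
      α ≤ supProb δ P {x | 0 ≤ ⟪u, x - (a • y + b • z)⟫} := by
    intro w hw hle
    refine (hw.trans (robustDepth_le_supProb δ w P hu)).trans (supProb_mono δ P fun x hx => ?_)
    rw [Set.mem_ofPred_eq, inner_sub_right] at hx ⊢
    linarith
  have hcomb : ⟪u, a • y + b • z⟫ = a * ⟪u, y⟫ + b * ⟪u, z⟫ := by
    rw [inner_add_right, real_inner_smul_right, real_inner_smul_right]
  rcases le_total ⟪u, y⟫ ⟪u, z⟫ with h | h
  · exact key z hz (hcomb.trans_le ((Convex.combo_le_max _ _ ha hb hab).trans (max_le h le_rfl)))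
  · exact key y hy (hcomb.trans_le ((Convex.combo_le_max _ _ ha hb hab).trans (max_le le_rfl h)))
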